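/- arXiv:0712.1521 — 5 statements merged into one kernel-verified Lean document; each statement's English description precedes it below -/
import Mathlib

section
/- For an asymmetric binary relation ≺, being upper-imitating is equivalent to being lower-imitating. -/
/-- The incomparability relation associated to a binary relation. -/
def Incomp {A : Type*} (r : A → A → Prop) (a b : A) : Prop :=
  ¬ r a b ∧ ¬ r b a

/-- `r` is lower-imitating: incomparable elements have the same predecessors. -/
def LowerImitating {A : Type*} (r : A → A → Prop) : Prop :=
  ∀ a b c, Incomp r a b → r c a → r c b

/-- `r` is upper-imitating: incomparable elements have the same successors. -/
def UpperImitating {A : Type*} (r : A → A → Prop) : Prop :=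
  ∀ a b c, Incomp r a b → r a c → r b c

/-- For an asymmetric relation, upper imitation is equivalent to lower imitation. -/
theorem upper_imitating_iff_lower_imitating_of_asymmetric {A : Type*}
    (r : A → A → Prop) (asym : ∀ a b, r a b → ¬ r b a) :
    UpperImitating r ↔ LowerImitating r := by
  constructor
  · intro h a b c hab hca
    by_contra hcb
    by_cases hbc : r b c
    · exact asym c a hca (h b a c ⟨hab.2, hab.1⟩ hbc)
    · exact hab.2 (h c b a ⟨hcb, hbc⟩ hca)
  · intro h a b c hab hac
    by_contra hbc
    by_cases hcb : r c b
    · exact asym a c hac (h b a c ⟨hab.2, hab.1⟩ hcb)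
    · exact hab.1 (h c b a ⟨hcb, hbc⟩ hac)
end

section
/- Let ≺ be a binary relation without any cycle involving 2 or 3 elements, i.e., there are no α, β with α ≺ β ≺ α and no α, β, γ with α ≺ β ≺ γ ≺ α. If ≺ is imitating, then ≺ is transitive. -/
/-- An imitating relation without cycles of length 2 or 3 is transitive. -/
theorem transitive_of_imitating_no_small_cycles {A : Type*} (r : A → A → Prop)
    (no2 : ∀ a b, ¬ (r a b ∧ r b a))
    (no3 : ∀ a b c, ¬ (r a b ∧ r b c ∧ r c a))
    (hlow : LowerImitating r) (hup : UpperImitating r) :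
    ∀ a b c, r a b → r b c → r a c := by
  intro a b c hab hbc
  by_contra hac
  exact no2 b c ⟨hbc, hup a c b ⟨hac, fun hca => no3 a b c ⟨hab, hbc, hca⟩⟩ hab⟩
end

section
/- Let ≺ be a binary relation without any cycle involving 2 or 3 elements, i.e., there are no α, β with α ≺ β ≺ α and no α, β, γ with α ≺ β ≺ γ ≺ α. If ≺ is imitating, then ≺ is a strict weak order (asymmetric with transitive negation). -/
/-- An imitating relation without cycles of length 2 or 3 is a strict weak
order: it is asymmetric and its negation is transitive. -/
theorem strict_weak_order_of_imitating_no_small_cycles {A : Type*}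
    (r : A → A → Prop)
    (no2 : ∀ a b, ¬ (r a b ∧ r b a))
    (no3 : ∀ a b c, ¬ (r a b ∧ r b c ∧ r c a))
    (hlow : LowerImitating r) (hup : UpperImitating r) :
    (∀ a b, r a b → ¬ r b a) ∧
    (∀ a b c, ¬ r a b → ¬ r b c → ¬ r a c) := by
  refine ⟨fun a b h h2 => no2 a b ⟨h, h2⟩, fun a b c hab hbc hac => ?_⟩
  by_cases hba : r b a
  · by_cases hcb : r c b
    · exact no3 a c b ⟨hac, hcb, hba⟩
    · exact hab (hlow c b a ⟨hcb, hbc⟩ hac)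
  · exact hbc (hup a b c ⟨hab, hba⟩ hac)
end

section
/- An E-prefix strict weak order on infinite sequences is A-transitive: if ≺ is asymmetric, has transitive negation, and satisfies uα ≺ uβ → α ≺ β for all finite u, then α ≺ β and uβ ≺ γ imply uα ≺ γ. -/
/-- Prepend an element to an infinite sequence. -/
def consSeq {A : Type*} (a : A) (α : ℕ → A) : ℕ → A
  | 0 => a
  | n + 1 => α n

/-- Prepend a finite sequence to an infinite sequence. -/
def prepend {A : Type*} (u : List A) (α : ℕ → A) : ℕ → A :=
  u.foldr consSeq α

/-- An E-prefix strict weak order on infinite sequences is A-transitive. -/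
theorem eprefix_swo_atransitive {A : Type*}
    (r : (ℕ → A) → (ℕ → A) → Prop)
    (asym : ∀ α β, r α β → ¬ r β α)
    (negtrans : ∀ α β γ, ¬ r α β → ¬ r β γ → ¬ r α γ)
    (eprefix : ∀ (u : List A) α β, r (prepend u α) (prepend u β) → r α β) :
    ∀ (u : List A) α β γ, r α β → r (prepend u β) γ → r (prepend u α) γ := by
  intro u α β γ h h'
  by_contra hn
  exact negtrans _ _ _ (fun k => asym _ _ h (eprefix u _ _ k)) hn h'
end

section
/- A dalograph whose labels are the elements of a set equipped with a strict weak order ≺ has a global equilibrium with respect to the lexicographic extension ≺^lex of ≺. -/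
/-- The lexicographic extension of a relation to infinite sequences. -/
inductive LexExt {A : Type*} (r : A → A → Prop) : (ℕ → A) → (ℕ → A) → Prop
  | base {a b : A} (α β : ℕ → A) : r a b → LexExt r (consSeq a α) (consSeq b β)
  | step {a b : A} {α β : ℕ → A} : LexExt r α β → ¬ r a b → ¬ r b a →
      LexExt r (consSeq a α) (consSeq b β)

/-- A path in a dalograph: an infinite sequence of nodes following arcs such
that, whenever a node is revisited, the same successor as on the first visit
is taken. -/
def IsDaloPath {V : Type*} (edge : V → V → Prop) (p : ℕ → V) : Prop :=
  (∀ n, edge (p n) (p (n + 1))) ∧ ∀ m n, p m = p n → p (m + 1) = p (n + 1)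

theorem lexExt_exists_index {A : Type*} {r : A → A → Prop} {α β : ℕ → A} (h : LexExt r α β) :
    ∃ N, r (α N) (β N) ∧ ∀ n < N, ¬ r (α n) (β n) ∧ ¬ r (β n) (α n) := by
  induction h with
  | base α β h => exact ⟨0, h, by simp⟩
  | step _ h1 h2 ih =>
    obtain ⟨N, hN, hlt⟩ := ih
    refine ⟨N + 1, hN, ?_⟩
    intro n hn
    cases n with
    | zero => exact ⟨h1, h2⟩
    | succ n => exact hlt n (by omega)

/-- Existence of a solution of the discounted optimality equation. -/
theorem bellman_exists {V : Type} [Fintype V] (edge : V → V → Prop) (c : V → V → ℝ)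
    (he : ∀ v, ∃ w, edge v w) (b : ℝ) (hb0 : 0 ≤ b) (hb1 : b < 1) :
    ∃ (x : V → ℝ) (s : V → V), (∀ v, edge v (s v)) ∧ (∀ v, x v = c v (s v) + b * x (s v)) ∧
      ∀ v w, edge v w → c v w + b * x w ≤ x v := by
  classical
  have hne : ∀ v, (Finset.univ.filter (edge v)).Nonempty := fun v => by
    obtain ⟨w, hw⟩ := he v
    exact ⟨w, by simpa using hw⟩
  let T : (V → ℝ) → (V → ℝ) := fun x v =>
    (Finset.univ.filter (edge v)).sup' (hne v) (fun w => c v w + b * x w)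
  have key : ∀ x y v, T x v ≤ T y v + b * dist x y := by
    intro x y v
    apply Finset.sup'_le
    intro w hw
    have h1 : c v w + b * y w ≤ T y v :=
      Finset.le_sup' (fun w => c v w + b * y w) hw
    have h2 : x w - y w ≤ dist x y :=
      (le_abs_self _).trans (by rw [← Real.dist_eq]; exact dist_le_pi_dist x y w)
    nlinarith [mul_le_mul_of_nonneg_left h2 hb0]
  have hT : ContractingWith ⟨b, hb0⟩ T := by
    refine ⟨by exact_mod_cast hb1, LipschitzWith.of_dist_le_mul ?_⟩
    intro x y
    refine (dist_pi_le_iff (mul_nonneg hb0 dist_nonneg)).2 ?_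
    intro v
    rw [Real.dist_eq, abs_le]
    have h1 := key x y v
    have h2 := key y x v
    rw [dist_comm y x] at h2
    change -(b * dist x y) ≤ _ ∧ _ ≤ b * dist x y
    constructor <;> linarith
  obtain ⟨x, hx⟩ : ∃ x, T x = x := ⟨_, hT.fixedPoint_isFixedPt⟩
  have hs : ∀ v, ∃ w, edge v w ∧ x v = c v w + b * x w := by
    intro v
    obtain ⟨w, hw, h⟩ := Finset.exists_mem_eq_sup' (hne v) (fun w => c v w + b * x w)
    exact ⟨w, by simpa using hw, (congrFun hx v).symm.trans h⟩
  choose s hs1 hs2 using hs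
  refine ⟨x, s, hs1, hs2, ?_⟩
  intro v w hw
  rw [← congrFun hx v]
  exact Finset.le_sup' (fun w => c v w + b * x w) (by simpa using hw)

/-- A dalograph labelled with elements of a strict weak order has a global
equilibrium with respect to the lexicographic extension of the strict weak
order: there is a strategy `s` choosing one outgoing arc at every node such
that from every node the induced path is maximal for `LexExt r`. -/
theorem equilibrium_for_lexExt {L : Type*} (r : L → L → Prop)
    (asym : ∀ a b, r a b → ¬ r b a)
    (negtrans : ∀ a b c, ¬ r a b → ¬ r b c → ¬ r a c) :
    ∀ (V : Type) (_ : Fintype V) (edge : V → V → Prop) (label : V → V → L),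
      (∀ v, ∃ w, edge v w) →
      ∃ s : V → V, (∀ v, edge v (s v)) ∧
        ∀ (o : V) (p : ℕ → V), IsDaloPath edge p → p 0 = o →
          ¬ LexExt r (fun n => label (s^[n] o) (s^[n + 1] o))
                     (fun n => label (p n) (p (n + 1))) := by
  intro V _ edge label he
  classical
  let c : V → V → ℕ := fun v w =>
    (Finset.univ.filter (fun q : V × V => r (label q.1 q.2) (label v w))).card
  have mono : ∀ v w v' w', ¬ r (label v' w') (label v w) → c v w ≤ c v' w' := by
    intro v w v' w' h
    apply Finset.card_le_card
    intro q hq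
    simp only [Finset.mem_filter, Finset.mem_univ, true_and] at hq ⊢
    by_contra hc
    exact negtrans _ _ _ hc h hq
  have smono : ∀ v w v' w', r (label v w) (label v' w') → c v w + 1 ≤ c v' w' := by
    intro v w v' w' h
    apply Finset.card_lt_card
    rw [Finset.ssubset_iff_of_subset]
    · refine ⟨(v, w), by simpa using h, ?_⟩
      simp only [Finset.mem_filter, Finset.mem_univ, true_and]
      exact fun h' => asym _ _ h' h'
    · intro q hq
      simp only [Finset.mem_filter, Finset.mem_univ, true_and] at hq ⊢
      by_contra hc
      exact negtrans _ _ _ hc (asym _ _ h) hq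
  obtain ⟨M, hM⟩ : ∃ M : ℝ, M = (Fintype.card (V × V) : ℕ) := ⟨_, rfl⟩
  have hM0 : 0 ≤ M := by rw [hM]; positivity
  have hcM : ∀ v w, (c v w : ℝ) ≤ M := by
    intro v w
    rw [hM]
    exact_mod_cast Finset.card_le_univ _
  obtain ⟨b, hb⟩ : ∃ b : ℝ, b = 1 / (M + 2) := ⟨_, rfl⟩
  have hb0 : 0 < b := by rw [hb]; positivity
  have hbM : b * (M + 2) = 1 := by rw [hb]; field_simp
  have hb1 : b < 1 := by nlinarith
  obtain ⟨x, s, hs1, hs2, hle⟩ :=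
    bellman_exists edge (fun v w => (c v w : ℝ)) he b hb0.le hb1
  refine ⟨s, hs1, ?_⟩
  intro o p hp hp0 hlex
  haveI : Nonempty V := ⟨o⟩
  have hx0 : ∀ v, 0 ≤ x v := by
    obtain ⟨m, hm⟩ := Finite.exists_min x
    have h1 := hs2 m
    have h2 := mul_le_mul_of_nonneg_left (hm (s m)) hb0.le
    have h3 : (0 : ℝ) ≤ c m (s m) := Nat.cast_nonneg _
    have h4 : 0 ≤ x m := by
      by_contra hneg
      nlinarith
    exact fun v => h4.trans (hm v)
  have hx1 : ∀ v, b * x v < 1 := by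
    obtain ⟨m, hm⟩ := Finite.exists_max x
    have h1 := hs2 m
    have h2 := mul_le_mul_of_nonneg_left (hm (s m)) hb0.le
    have h3 := hcM m (s m)
    have h4 : b * x m < 1 := by
      by_contra hneg
      push Not at hneg
      have h5 : x m ≤ M + b * x m := by
        linarith
      have h6 : b * x m ≤ b * M + b * (b * x m) := by nlinarith
      nlinarith
    exact fun v => (mul_le_mul_of_nonneg_left (hm v) hb0.le).trans_lt h4
  obtain ⟨N, hN, hlt⟩ := lexExt_exists_index hlex
  have inv : ∀ n ≤ N, x (p n) ≤ x (s^[n] o) := by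
    intro n
    induction n with
    | zero => intro _; simp [hp0]
    | succ n ih =>
      intro hn
      have h0 := ih (by omega)
      obtain ⟨h1, h2⟩ := hlt n (by omega)
      have h3 : c (s^[n] o) (s^[n + 1] o) = c (p n) (p (n + 1)) :=
        le_antisymm (mono _ _ _ _ h2) (mono _ _ _ _ h1)
      have h4 := hs2 (s^[n] o)
      have h5 := hle _ _ (hp.1 n)
      rw [Function.iterate_succ_apply'] at h3 ⊢
      simp only [h3] at h4 h5
      have h6 : b * x (p (n + 1)) ≤ b * x (s (s^[n] o)) := by linarith
      exact le_of_mul_le_mul_left h6 hb0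
  have h0 := inv N le_rfl
  have h1 := smono _ _ _ _ hN
  have h4 := hs2 (s^[N] o)
  have h5 := hle _ _ (hp.1 N)
  rw [Function.iterate_succ_apply'] at h1
  have h6 : (c (s^[N] o) (s (s^[N] o)) : ℝ) + 1 ≤ c (p N) (p (N + 1)) := by exact_mod_cast h1
  have h7 := hx1 (s (s^[N] o))
  have h8 := mul_nonneg hb0.le (hx0 (p (N + 1)))
  linarith
end
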